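/- arXiv:2109.05246 — 5 statements merged into one kernel-verified Lean document; each statement's English description precedes it below -/
import Mathlib

section
/- The function p(x) = (x coth(x) - 1)/x² is strictly decreasing on (0,∞); equivalently, p is differentiable on (0,∞) with p'(x) < 0 for all x > 0. -/
lemma aux_pos (f g : ℝ → ℝ) (h : ∀ x, HasDerivAt f (g x) x) (h0 : f 0 = 0)
    (hg : ∀ x, 0 < x → 0 < g x) : ∀ x, 0 < x → 0 < f x := by
  have hm : StrictMonoOn f (Set.Ici (0 : ℝ)) := by
    apply strictMonoOn_of_deriv_pos (convex_Ici 0)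
    · exact fun x _ => (h x).continuousAt.continuousWithinAt
    · intro x hx
      rw [interior_Ici] at hx
      rw [(h x).deriv]
      exact hg x hx
  intro x hx
  have := hm (Set.mem_Ici.2 le_rfl) (Set.mem_Ici.2 hx.le) hx
  rwa [h0] at this

open Real in
lemma aux_G : ∀ x : ℝ, 0 < x → 0 < x * cosh x - sinh x := by
  apply aux_pos _ (fun x => x * sinh x)
  · intro x
    refine HasDerivAt.congr_deriv (((hasDerivAt_id' x).mul (hasDerivAt_cosh x)).sub (hasDerivAt_sinh x)) ?_
    ring
  · simp
  · intro x hx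
    exact mul_pos hx (sinh_pos_iff.2 hx)

open Real in
lemma aux_F1 : ∀ x : ℝ, 0 < x →
    0 < 2 * x - 3 * (sinh x * cosh x) + x * (cosh x ^ 2 + sinh x ^ 2) := by
  apply aux_pos _ (fun x => 4 * sinh x * (x * cosh x - sinh x))
  · intro x
    refine HasDerivAt.congr_deriv ((((hasDerivAt_id' x).const_mul 2).sub
      (((hasDerivAt_sinh x).mul (hasDerivAt_cosh x)).const_mul 3)).add
      ((hasDerivAt_id' x).mul (((hasDerivAt_cosh x).pow 2).add ((hasDerivAt_sinh x).pow 2)))) ?_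
    simp
    linear_combination (-2) * cosh_sq_sub_sinh_sq x
  · simp
  · intro x hx
    have := sinh_pos_iff.2 hx
    have := aux_G x hx
    positivity

open Real in
lemma aux_F : ∀ x : ℝ, 0 < x →
    0 < x ^ 2 + x * (sinh x * cosh x) - 2 * sinh x ^ 2 := by
  apply aux_pos _ _ _ _ aux_F1
  · intro x
    refine HasDerivAt.congr_deriv ((((hasDerivAt_id' x).pow 2).add
      ((hasDerivAt_id' x).mul ((hasDerivAt_sinh x).mul (hasDerivAt_cosh x)))).sub
      (((hasDerivAt_sinh x).pow 2).const_mul 2)) ?_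
    simp
    ring
  · simp

/-- The function `p(x) = (x coth x - 1)/x²` is strictly decreasing on `(0,∞)`;
equivalently, `p` is differentiable on `(0,∞)` with `p'(x) < 0` for all `x > 0`. -/
theorem p_strictAnti (p : ℝ → ℝ)
    (hp : ∀ x, p x = (x * (Real.cosh x / Real.sinh x) - 1) / x ^ 2) :
    StrictAntiOn p (Set.Ioi (0 : ℝ)) ∧
      ∀ x : ℝ, 0 < x → DifferentiableAt ℝ p x ∧ deriv p x < 0 := by
  have key : ∀ x : ℝ, 0 < x → HasDerivAt p
      (-((x ^ 2 + x * (Real.sinh x * Real.cosh x) - 2 * Real.sinh x ^ 2)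
        / (x ^ 3 * Real.sinh x ^ 2))) x := by
    intro x hx
    have hs := Real.sinh_pos_iff.2 hx
    rw [funext hp]
    refine HasDerivAt.congr_deriv ((((hasDerivAt_id' x).mul ((Real.hasDerivAt_cosh x).div (Real.hasDerivAt_sinh x)
      hs.ne')).sub_const 1).div ((hasDerivAt_id' x).pow 2) (pow_pos hx 2).ne') ?_
    simp
    field_simp
    linear_combination (-x ^ 2) * Real.cosh_sq_sub_sinh_sq x
  have neg : ∀ x : ℝ, 0 < x → DifferentiableAt ℝ p x ∧ deriv p x < 0 := by
    intro x hx
    refine ⟨(key x hx).differentiableAt, ?_⟩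
    rw [(key x hx).deriv]
    have hs := Real.sinh_pos_iff.2 hx
    have := aux_F x hx
    exact neg_neg_of_pos (by positivity)
  refine ⟨?_, neg⟩
  apply strictAntiOn_of_deriv_neg (convex_Ioi 0)
  · exact fun x hx => (neg x hx).1.continuousAt.continuousWithinAt
  · intro x hx
    rw [interior_Ioi] at hx
    exact (neg x hx).2
end

section
/- Let α > 0 and Γ > 0 be real constants. The function l(x) = α p(x)/(α + √Γ g(x)) is differentiable on (0,∞) with l'(x) = (α² p'(x) - α √Γ p(x)²)/(α + √Γ g(x))² < 0 for every x > 0; in particular l is strictly decreasing on (0,∞). -/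
theorem aux_pos_s5 (f f' : ℝ → ℝ) (h0 : f 0 = 0) (hd : ∀ x, HasDerivAt f (f' x) x)
    (hpos : ∀ x, 0 < x → 0 < f' x) (x : ℝ) (hx : 0 < x) : 0 < f x := by
  have hm : StrictMonoOn f (Set.Ici 0) := by
    apply strictMonoOn_of_deriv_pos (convex_Ici 0)
    · exact fun y _ => (hd y).continuousAt.continuousWithinAt
    · intro y hy
      rw [interior_Ici] at hy
      rw [(hd y).deriv]
      exact hpos y hy
  have := hm (Set.mem_Ici.2 le_rfl) (Set.mem_Ici.2 hx.le) hx
  rwa [h0] at this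

theorem aux1 (x : ℝ) (hx : 0 < x) : 0 < x * Real.cosh x - Real.sinh x := by
  refine aux_pos_s5 (fun x => x * Real.cosh x - Real.sinh x) (fun x => x * Real.sinh x) (by simp)
    ?_ ?_ x hx
  · intro y
    refine HasDerivAt.congr_deriv (((hasDerivAt_id y).mul (Real.hasDerivAt_cosh y)).sub (Real.hasDerivAt_sinh y)) ?_
    simp
  · exact fun y hy => mul_pos hy (Real.sinh_pos_iff.2 hy)

theorem aux2 (x : ℝ) (hx : 0 < x) : 0 < 2 + x * Real.sinh x - 2 * Real.cosh x := by
  refine aux_pos_s5 (fun x => 2 + x * Real.sinh x - 2 * Real.cosh x)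
    (fun x => x * Real.cosh x - Real.sinh x) (by simp) ?_ aux1 x hx
  intro y
  refine HasDerivAt.congr_deriv ((((hasDerivAt_id y).mul (Real.hasDerivAt_sinh y)).const_add 2).sub
    ((Real.hasDerivAt_cosh y).const_mul 2)) ?_
  simp; ring

theorem aux3 (x : ℝ) (hx : 0 < x) : 0 < 2 * x + x * Real.cosh x - 3 * Real.sinh x := by
  refine aux_pos_s5 (fun x => 2 * x + x * Real.cosh x - 3 * Real.sinh x)
    (fun x => 2 + x * Real.sinh x - 2 * Real.cosh x) (by simp) ?_ aux2 x hx
  intro y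
  refine HasDerivAt.congr_deriv ((((hasDerivAt_id y).const_mul 2).add
    ((hasDerivAt_id y).mul (Real.hasDerivAt_cosh y))).sub
    ((Real.hasDerivAt_sinh y).const_mul 3)) ?_
  simp; ring

theorem aux4 (x : ℝ) (hx : 0 < x) : 0 < x ^ 2 + x * Real.sinh x - 4 * Real.cosh x + 4 := by
  refine aux_pos_s5 (fun x => x ^ 2 + x * Real.sinh x - 4 * Real.cosh x + 4)
    (fun x => 2 * x + x * Real.cosh x - 3 * Real.sinh x) (by simp) ?_ aux3 x hx
  intro y
  refine HasDerivAt.congr_deriv ((((hasDerivAt_pow 2 y).add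
    ((hasDerivAt_id y).mul (Real.hasDerivAt_sinh y))).sub
    ((Real.hasDerivAt_cosh y).const_mul 4)).add_const 4) ?_
  simp; ring

theorem aux5 (x : ℝ) (hx : 0 < x) :
    0 < x ^ 2 + x * Real.sinh x * Real.cosh x - 2 * Real.sinh x ^ 2 := by
  have h := aux4 (2 * x) (by linarith)
  rw [Real.sinh_two_mul, Real.cosh_two_mul] at h
  have := Real.cosh_sq x
  nlinarith

/-- Let `α > 0`, `Γ > 0`. The function `l(x) = α p(x)/(α + √Γ g(x))` is differentiable
on `(0,∞)` with `l'(x) = (α² p'(x) - α √Γ p(x)²)/(α + √Γ g(x))² < 0` for every `x > 0`;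
in particular `l` is strictly decreasing on `(0,∞)`. -/
theorem l_deriv_neg (α Γ : ℝ) (hα : 0 < α) (hΓ : 0 < Γ)
    (g p l : ℝ → ℝ)
    (hg : ∀ x, g x = Real.cosh x / Real.sinh x - 1 / x)
    (hp : ∀ x, p x = (x * (Real.cosh x / Real.sinh x) - 1) / x ^ 2)
    (hl : ∀ x, l x = α * p x / (α + Real.sqrt Γ * g x)) :
    (∀ x : ℝ, 0 < x →
      HasDerivAt l
        ((α ^ 2 * deriv p x - α * Real.sqrt Γ * (p x) ^ 2) / (α + Real.sqrt Γ * g x) ^ 2) x ∧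
      (α ^ 2 * deriv p x - α * Real.sqrt Γ * (p x) ^ 2) / (α + Real.sqrt Γ * g x) ^ 2 < 0) ∧
    StrictAntiOn l (Set.Ioi (0 : ℝ)) := by
  have key : ∀ x : ℝ, 0 < x →
      HasDerivAt l
        ((α ^ 2 * deriv p x - α * Real.sqrt Γ * (p x) ^ 2) / (α + Real.sqrt Γ * g x) ^ 2) x ∧
      (α ^ 2 * deriv p x - α * Real.sqrt Γ * (p x) ^ 2) / (α + Real.sqrt Γ * g x) ^ 2 < 0 := by
    intro x hx
    have hs : 0 < Real.sinh x := Real.sinh_pos_iff.2 hx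
    have hq : 0 < Real.sqrt Γ := Real.sqrt_pos.2 hΓ
    have h1 := aux1 x hx
    have h5 := aux5 x hx
    have hpx : 0 < p x := by
      rw [hp]
      apply div_pos _ (by positivity)
      have : x * (Real.cosh x / Real.sinh x) - 1
        = (x * Real.cosh x - Real.sinh x) / Real.sinh x := by field_simp
      rw [this]; positivity
    have hgp : ∀ y, g y = y * p y := by
      intro y
      rw [hg, hp]
      rcases eq_or_ne y 0 with rfl | hy
      · simp
      · field_simp
    have hden : 0 < α + Real.sqrt Γ * g x := by rw [hgp]; positivity
    have hdp : HasDerivAt p (-(x ^ 2 + x * Real.sinh x * Real.cosh x - 2 * Real.sinh x ^ 2)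
        / (x ^ 3 * Real.sinh x ^ 2)) x := by
      rw [funext hp]
      have hc := Real.cosh_sq x
      refine HasDerivAt.congr_deriv ((((hasDerivAt_id x).mul ((Real.hasDerivAt_cosh x).div (Real.hasDerivAt_sinh x)
        hs.ne')).sub_const 1).div (hasDerivAt_pow 2 x) (by positivity)) ?_
      simp
      field_simp
      rw [hc]; ring
    have hdneg : deriv p x < 0 := by
      rw [hdp.deriv]
      exact div_neg_of_neg_of_pos (by linarith) (by positivity)
    have hdp' := hdp.differentiableAt.hasDerivAt
    refine ⟨?_, ?_⟩
    · have hdg : HasDerivAt g (1 * p x + x * deriv p x) x := by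
        rw [funext hgp]
        exact (hasDerivAt_id x).mul hdp'
      rw [funext hl]
      refine HasDerivAt.congr_deriv ((hdp'.const_mul α).div ((hdg.const_mul (Real.sqrt Γ)).const_add α) hden.ne') ?_
      congr 1
      rw [hgp]; ring
    · apply div_neg_of_neg_of_pos _ (by positivity)
      have a1 : α ^ 2 * deriv p x < 0 := mul_neg_of_pos_of_neg (by positivity) hdneg
      have a2 : 0 < α * Real.sqrt Γ * (p x) ^ 2 := by positivity
      linarith
  refine ⟨key, ?_⟩
  apply strictAntiOn_of_deriv_neg (convex_Ioi 0)
  · exact fun y hy => (key y hy).1.continuousAt.continuousWithinAt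
  · intro y hy
    rw [interior_Ioi] at hy
    rw [(key y hy).1.deriv]
    exact (key y hy).2
end

section
/- Let α > 0, Γ > 0, and let Λ be a real number with 0 < Λ < 1/3. Then there exists a unique x_s > 0 such that l(x_s) = Λ, where l(x) = α p(x)/(α + √Γ g(x)). Consequently the delay equation ω'(t) = a[l(ω(t-τ₁)^{1/3}) ω(t-τ₁) - Λ ω(t-τ₂)] has a unique positive stationary solution ω_s = x_s³. -/
open Real Set in
lemma aux_pos_of_deriv (f f' : ℝ → ℝ) (h0 : f 0 = 0) (hd : ∀ x, HasDerivAt f (f' x) x)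
    (hp : ∀ x, 0 < x → 0 < f' x) : ∀ x, 0 < x → 0 < f x := by
  intro x hx
  have h : StrictMonoOn f (Ici 0) := by
    apply strictMonoOn_of_deriv_pos (convex_Ici 0)
    · exact fun y _ => (hd y).continuousAt.continuousWithinAt
    · intro y hy
      rw [interior_Ici] at hy
      rw [(hd y).deriv]; exact hp y hy
  have := h (mem_Ici.2 le_rfl) (mem_Ici.2 hx.le) hx
  rwa [h0] at this

lemma aux_sinh (x : ℝ) (hx : 0 < x) : x < Real.sinh x := Real.self_lt_sinh_iff.2 hx

lemma aux_xc (x : ℝ) (hx : 0 < x) : x ^ 3 / 3 < x * Real.cosh x - Real.sinh x := by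
  have := aux_pos_of_deriv (fun x => x * Real.cosh x - Real.sinh x - x ^ 3 / 3)
    (fun x => x * (Real.sinh x - x)) (by simp)
    (fun x => by
      have := (((hasDerivAt_id x).mul (Real.hasDerivAt_cosh x)).sub (Real.hasDerivAt_sinh x)).sub
        ((hasDerivAt_pow 3 x).div_const 3)
      refine this.congr_deriv ?_
      simp; ring)
    (fun x hx => mul_pos hx (sub_pos.2 (aux_sinh x hx))) x hx
  linarith

lemma aux_k1 (x : ℝ) (hx : 0 < x) :
    0 < 3 * x - 3 * (Real.sinh x * Real.cosh x) + 2 * (x * Real.sinh x ^ 2) := by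
  refine aux_pos_of_deriv
    (fun x => 3 * x - 3 * (Real.sinh x * Real.cosh x) + 2 * (x * Real.sinh x ^ 2))
    (fun x => 4 * Real.sinh x * (x * Real.cosh x - Real.sinh x)) (by simp) (fun x => ?_)
    (fun x hx => ?_) x hx
  · have := (((hasDerivAt_id x).const_mul 3).sub
      (((Real.hasDerivAt_sinh x).mul (Real.hasDerivAt_cosh x)).const_mul 3)).add
      (((hasDerivAt_id x).mul ((Real.hasDerivAt_sinh x).pow 2)).const_mul 2)
    refine this.congr_deriv ?_
    have h := Real.cosh_sq x
    simp
    linear_combination -3 * h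
  · have := aux_xc x hx
    have h3 : 0 < x ^ 3 / 3 := by positivity
    have := aux_sinh x hx
    exact mul_pos (by linarith) (by linarith)

lemma aux_k (x : ℝ) (hx : 0 < x) :
    0 < x ^ 2 + x * (Real.sinh x * Real.cosh x) - 2 * Real.sinh x ^ 2 := by
  refine aux_pos_of_deriv
    (fun x => x ^ 2 + x * (Real.sinh x * Real.cosh x) - 2 * Real.sinh x ^ 2)
    (fun x => 3 * x - 3 * (Real.sinh x * Real.cosh x) + 2 * (x * Real.sinh x ^ 2))
    (by simp) (fun x => ?_) aux_k1 x hx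
  have := ((hasDerivAt_pow 2 x).add ((hasDerivAt_id x).mul
      ((Real.hasDerivAt_sinh x).mul (Real.hasDerivAt_cosh x)))).sub
      (((Real.hasDerivAt_sinh x).pow 2).const_mul 2)
  refine this.congr_deriv ?_
  have h := Real.cosh_sq x
  simp
  linear_combination x * h

noncomputable def auxF (Λ K x : ℝ) : ℝ :=
  (x * (Real.cosh x / Real.sinh x) - 1) / x ^ 2 - Λ - K * (Real.cosh x / Real.sinh x - 1 / x)

lemma auxF_deriv (Λ K x : ℝ) (hx : 0 < x) : HasDerivAt (auxF Λ K)
    (-(x ^ 2 + x * (Real.sinh x * Real.cosh x) - 2 * Real.sinh x ^ 2) / (x ^ 3 * Real.sinh x ^ 2)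
      - K * ((Real.sinh x ^ 2 - x ^ 2) / (x ^ 2 * Real.sinh x ^ 2))) x := by
  have hs : Real.sinh x ≠ 0 := by have := aux_sinh x hx; linarith
  have hx0 := hx.ne'
  have hcoth := (Real.hasDerivAt_cosh x).div (Real.hasDerivAt_sinh x) hs
  have h1 := (((hasDerivAt_id x).mul hcoth).sub_const 1).div (hasDerivAt_pow 2 x)
    (by positivity)
  have h2 := (hcoth.sub ((hasDerivAt_const x (1:ℝ)).div (hasDerivAt_id x) hx0)).const_mul K
  refine ((h1.sub_const Λ).sub h2).congr_deriv ?_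
  have h := Real.cosh_sq x
  simp
  field_simp
  rw [h]
  ring

lemma auxF_anti (Λ K : ℝ) (hK : 0 ≤ K) : StrictAntiOn (auxF Λ K) (Set.Ioi 0) := by
  apply strictAntiOn_of_deriv_neg (convex_Ioi 0)
  · exact fun y hy => (auxF_deriv Λ K y hy).continuousAt.continuousWithinAt
  · intro x hx
    rw [interior_Ioi] at hx
    have hx : 0 < x := hx
    rw [(auxF_deriv Λ K x hx).deriv]
    have hs := aux_sinh x hx
    have hs0 : 0 < Real.sinh x := hx.trans hs
    have h1 := div_pos (aux_k x hx) (show 0 < x ^ 3 * Real.sinh x ^ 2 by positivity)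
    have h2 : 0 ≤ K * ((Real.sinh x ^ 2 - x ^ 2) / (x ^ 2 * Real.sinh x ^ 2)) := by
      have : 0 ≤ Real.sinh x ^ 2 - x ^ 2 := by nlinarith
      positivity
    rw [neg_div]
    linarith

lemma aux_g_pos (x : ℝ) (hx : 0 < x) : 0 < Real.cosh x / Real.sinh x - 1 / x := by
  have hs0 : 0 < Real.sinh x := hx.trans (aux_sinh x hx)
  have := aux_xc x hx
  have h3 : 0 < x ^ 3 / 3 := by positivity
  rw [div_sub_div _ _ hs0.ne' hx.ne']
  apply div_pos _ (by positivity)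
  linarith

lemma aux_g_le (x : ℝ) (hx : 0 < x) :
    Real.cosh x / Real.sinh x - 1 / x ≤ (Real.cosh x - 1) / Real.sinh x := by
  have hs := aux_sinh x hx
  have : 1 / Real.sinh x ≤ 1 / x := one_div_le_one_div_of_le hx hs.le
  rw [sub_div]
  linarith

lemma auxF_exists (Λ K : ℝ) (hK : 0 ≤ K) (hΛ : 0 < Λ) (hΛ' : Λ < 1 / 3) :
    ∃ x, 0 < x ∧ auxF Λ K x = 0 := by
  obtain ⟨u, hu, hFu⟩ : ∃ u, 0 < u ∧ 0 ≤ auxF Λ K u := by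
    have hc : ContinuousAt (fun x => 1 / (3 * Real.cosh x) - Λ - K * Real.sinh x) 0 := by
      have : ∀ x, 3 * Real.cosh x ≠ 0 := fun x => by have := Real.cosh_pos x; positivity
      have : Continuous (fun x => 1 / (3 * Real.cosh x) - Λ - K * Real.sinh x) := by
        fun_prop (disch := exact this _)
      exact this.continuousAt
    have hev := hc.eventually (lt_mem_nhds (a := 0) (by simp; linarith))
    have hev2 := (hev.filter_mono nhdsWithin_le_nhds).and
      (self_mem_nhdsWithin (a := (0:ℝ)) (s := Set.Ioi 0))
    obtain ⟨u, h, hu⟩ := hev2.exists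
    have hu : 0 < u := hu
    refine ⟨u, hu, ?_⟩
    have hs := aux_sinh u hu
    have hs0 : 0 < Real.sinh u := hu.trans hs
    have hc1 := Real.one_le_cosh u
    have hsq := Real.cosh_sq u
    have hx := aux_xc u hu
    have h3 : 0 < u ^ 3 / 3 := by positivity
    have hg : Real.cosh u / Real.sinh u - 1 / u ≤ Real.sinh u := by
      refine (aux_g_le u hu).trans ?_
      rw [div_le_iff₀ hs0]
      nlinarith
    have hp : 1 / (3 * Real.cosh u) ≤ (u * (Real.cosh u / Real.sinh u) - 1) / u ^ 2 := by
      have e : (u * (Real.cosh u / Real.sinh u) - 1) / u ^ 2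
        = (u * Real.cosh u - Real.sinh u) / (u ^ 2 * Real.sinh u) := by
        field_simp
      rw [e, div_le_div_iff₀ (by positivity) (by positivity)]
      have h4 : u ^ 2 * Real.sinh u ≤ u ^ 2 * (u * Real.cosh u) := by
        apply mul_le_mul_of_nonneg_left _ (by positivity); linarith
      have h5 := mul_le_mul_of_nonneg_right hx.le (show 0 ≤ 3 * Real.cosh u by linarith)
      nlinarith
    have := mul_le_mul_of_nonneg_left hg hK
    unfold auxF
    linarith
  obtain ⟨v, hv, hFv⟩ : ∃ v, 0 < v ∧ auxF Λ K v ≤ 0 := by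
    have hv : 0 < 1 / Λ := by positivity
    refine ⟨1 / Λ, hv, ?_⟩
    generalize hw : 1 / Λ = v at hv
    have hs0 : 0 < Real.sinh v := hv.trans (aux_sinh v hv)
    have hg : Real.cosh v / Real.sinh v - 1 / v ≤ 1 := by
      refine (aux_g_le v hv).trans ?_
      rw [div_le_one hs0]
      have := Real.cosh_sq v
      nlinarith [Real.one_le_cosh v]
    have e : (v * (Real.cosh v / Real.sinh v) - 1) / v ^ 2
        = (Real.cosh v / Real.sinh v - 1 / v) * (1 / v) := by
      field_simp
    have e2 : 1 / v = Λ := by rw [← hw]; simp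
    have := mul_le_mul_of_nonneg_right hg hΛ.le
    have := mul_nonneg hK (aux_g_pos v hv).le
    unfold auxF
    rw [e]
    nth_rewrite 2 [e2]
    linarith
  have hcont : ContinuousOn (auxF Λ K) (Set.Ioi 0) :=
    fun y hy => (auxF_deriv Λ K y hy).continuousAt.continuousWithinAt
  obtain ⟨x, hx, hx0⟩ := isPreconnected_Ioi.intermediate_value (a := v) (b := u) hv hu hcont
    (⟨hFv, hFu⟩ : (0:ℝ) ∈ Set.Icc _ _)
  exact ⟨x, hx, hx0⟩


/-- Let `α > 0`, `Γ > 0`, and `0 < Λ < 1/3`. Then there exists a unique `x_s > 0` with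
`l(x_s) = Λ`, and consequently the delay equation
`ω'(t) = a[l(ω(t-τ₁)^{1/3}) ω(t-τ₁) - Λ ω(t-τ₂)]` has a unique positive stationary
solution `ω_s = x_s³`. -/
theorem exists_unique_stationary (α Γ Λ a : ℝ) (hα : 0 < α) (hΓ : 0 < Γ)
    (hΛ : 0 < Λ ∧ Λ < 1 / 3) (ha : 0 < a)
    (g p l : ℝ → ℝ)
    (hg : ∀ x, g x = Real.cosh x / Real.sinh x - 1 / x)
    (hp : ∀ x, p x = (x * (Real.cosh x / Real.sinh x) - 1) / x ^ 2)
    (hl : ∀ x, l x = α * p x / (α + Real.sqrt Γ * g x)) :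
    (∃! x : ℝ, 0 < x ∧ l x = Λ) ∧
    (∃! ω : ℝ, 0 < ω ∧ a * (l (ω ^ ((1 : ℝ) / 3)) * ω - Λ * ω) = 0) ∧
    (∀ x : ℝ, 0 < x → l x = Λ →
      a * (l ((x ^ 3) ^ ((1 : ℝ) / 3)) * x ^ 3 - Λ * x ^ 3) = 0) := by
  obtain ⟨hΛ0, hΛ1⟩ := hΛ
  have hK : 0 ≤ Λ * Real.sqrt Γ / α := by positivity
  have key : ∀ x, 0 < x → (l x = Λ ↔ auxF Λ (Λ * Real.sqrt Γ / α) x = 0) := by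
    intro x hx
    have hgp : 0 < g x := by rw [hg]; exact aux_g_pos x hx
    have hden : 0 < α + Real.sqrt Γ * g x := by positivity
    have e : auxF Λ (Λ * Real.sqrt Γ / α) x = p x - Λ - Λ * Real.sqrt Γ / α * g x := by
      rw [hp, hg]; rfl
    rw [hl, div_eq_iff hden.ne', e]
    have e2 : α * (p x - Λ - Λ * Real.sqrt Γ / α * g x)
        = α * p x - Λ * (α + Real.sqrt Γ * g x) := by
      field_simp
      ring
    constructor
    · intro h
      have : α * (p x - Λ - Λ * Real.sqrt Γ / α * g x) = 0 := by rw [e2, h]; ring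
      exact (mul_eq_zero.1 this).resolve_left hα.ne'
    · intro h
      rw [h] at e2
      linarith
  obtain ⟨x, hx, hFx⟩ := auxF_exists Λ _ hK hΛ0 hΛ1
  have huniq : ∀ y, 0 < y → l y = Λ → y = x := by
    intro y hy h
    exact (auxF_anti Λ _ hK).injOn hy hx (((key y hy).1 h).trans hFx.symm)
  have hlx : l x = Λ := (key x hx).2 hFx
  have hcube : ∀ y : ℝ, 0 < y → (y ^ 3) ^ ((1 : ℝ) / 3) = y := by
    intro y hy
    rw [← Real.rpow_natCast, ← Real.rpow_mul hy.le]; norm_num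
  have hcube' : ∀ y : ℝ, 0 < y → (y ^ ((1 : ℝ) / 3)) ^ 3 = y := by
    intro y hy
    rw [← Real.rpow_natCast, ← Real.rpow_mul hy.le]; norm_num
  have hthird : ∀ x : ℝ, 0 < x → l x = Λ →
      a * (l ((x ^ 3) ^ ((1 : ℝ) / 3)) * x ^ 3 - Λ * x ^ 3) = 0 := by
    intro y hy h
    rw [hcube y hy, h]; ring
  refine ⟨⟨x, ⟨hx, hlx⟩, fun y hy => huniq y hy.1 hy.2⟩,
    ⟨x ^ 3, ⟨by positivity, hthird x hx hlx⟩, ?_⟩, hthird⟩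
  rintro ω ⟨hω, h⟩
  have h1 := (mul_eq_zero.1 h).resolve_left ha.ne'
  rw [← sub_mul] at h1
  have h2 := (mul_eq_zero.1 h1).resolve_right hω.ne'
  have h3 := huniq _ (Real.rpow_pos_of_pos hω _) (sub_eq_zero.1 h2)
  rw [← h3, hcube' ω hω]
end

section
/- Let α > 0 and Γ > 0. The function H(y) = y³ l(y) is strictly increasing on (0,∞), where l(x) = α p(x)/(α + √Γ g(x)). -/
theorem aux_pos_s11 (x : ℝ) (hx : 0 < x) : Real.sinh x < x * Real.cosh x := by
  have hd : ∀ t : ℝ, HasDerivAt (fun t => t * Real.cosh t - Real.sinh t) (t * Real.sinh t) t := by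
    intro t
    have h := ((hasDerivAt_id t).mul (Real.hasDerivAt_cosh t)).sub (Real.hasDerivAt_sinh t)
    refine HasDerivAt.congr_deriv h ?_
    simp
  have hm : StrictMonoOn (fun t => t * Real.cosh t - Real.sinh t) (Set.Ici (0 : ℝ)) := by
    apply strictMonoOn_of_deriv_pos (convex_Ici 0)
    · exact fun t _ => (hd t).continuousAt.continuousWithinAt
    · intro t ht
      rw [interior_Ici, Set.mem_Ioi] at ht
      rw [(hd t).deriv]
      exact mul_pos ht (Real.sinh_pos_iff.2 ht)
  have := hm (Set.mem_Ici.2 le_rfl) (Set.mem_Ici.2 hx.le) hx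
  simp at this
  linarith

theorem aux_mono :
    StrictMonoOn (fun t : ℝ => Real.cosh t / Real.sinh t - 1 / t) (Set.Ioi (0 : ℝ)) := by
  have hd : ∀ t : ℝ, 0 < t → HasDerivAt (fun t : ℝ => Real.cosh t / Real.sinh t - 1 / t)
      (1 / t ^ 2 - 1 / Real.sinh t ^ 2) t := by
    intro t ht
    have hs := Real.sinh_pos_iff.2 ht
    have h := ((Real.hasDerivAt_cosh t).div (Real.hasDerivAt_sinh t) hs.ne').sub
      ((hasDerivAt_const t (1 : ℝ)).div (hasDerivAt_id t) ht.ne')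
    refine HasDerivAt.congr_deriv h ?_
    have := Real.cosh_sq t
    simp only [id]
    field_simp
    rw [this]
    ring
  apply strictMonoOn_of_deriv_pos (convex_Ioi 0)
  · exact fun t ht => (hd t ht).continuousAt.continuousWithinAt
  · intro t ht
    rw [interior_Ioi, Set.mem_Ioi] at ht
    rw [(hd t ht).deriv, sub_pos]
    have := Real.self_lt_sinh_iff.2 ht
    exact one_div_lt_one_div_of_lt (by positivity) (by gcongr)

/-- Let `α > 0`, `Γ > 0`. The function `H(y) = y³ l(y)` is strictly increasing on
`(0,∞)`, where `l(x) = α p(x)/(α + √Γ g(x))`. -/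
theorem H_strictMono (α Γ : ℝ) (hα : 0 < α) (hΓ : 0 < Γ)
    (g p l : ℝ → ℝ)
    (hg : ∀ x, g x = Real.cosh x / Real.sinh x - 1 / x)
    (hp : ∀ x, p x = (x * (Real.cosh x / Real.sinh x) - 1) / x ^ 2)
    (hl : ∀ x, l x = α * p x / (α + Real.sqrt Γ * g x)) :
    StrictMonoOn (fun y : ℝ => y ^ 3 * l y) (Set.Ioi (0 : ℝ)) := by
  have hs : 0 < Real.sqrt Γ := Real.sqrt_pos.2 hΓ
  have gpos : ∀ x, 0 < x → 0 < g x := by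
    intro x hx
    rw [hg, sub_pos, div_lt_div_iff₀ hx (Real.sinh_pos_iff.2 hx)]
    have := aux_pos_s11 x hx
    linarith
  have key : ∀ x, 0 < x → x ^ 3 * l x = α * (x ^ 2 * g x) / (α + Real.sqrt Γ * g x) := by
    intro x hx
    have hpg : x ^ 3 * p x = x ^ 2 * g x := by
      have := (Real.sinh_pos_iff.2 hx).ne'
      rw [hp, hg]
      field_simp
    rw [hl, ← hpg]
    ring
  intro x hx y hy hxy
  rw [Set.mem_Ioi] at hx hy
  have hgxy : g x < g y := by
    rw [hg, hg]
    exact aux_mono hx hy hxy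
  have hgx := gpos x hx
  have hgy := gpos y hy
  have h2 : x ^ 2 < y ^ 2 := by gcongr
  show x ^ 3 * l x < y ^ 3 * l y
  rw [key x hx, key y hy, div_lt_div_iff₀ (by positivity) (by positivity)]
  have h1 : x ^ 2 * g x < y ^ 2 * g y := by gcongr
  have h3 : α * α * (x ^ 2 * g x) < α * α * (y ^ 2 * g y) := by gcongr
  have h4 : α * Real.sqrt Γ * g x * g y * x ^ 2 < α * Real.sqrt Γ * g x * g y * y ^ 2 := by gcongr
  linarith
end

section
/- Let α > 0 and Γ > 0. For every y > 0 one has y·l'(y) + 3·l(y) > 0, where l(x) = α p(x)/(α + √Γ g(x)) and l' denotes its derivative. (This is the key inequality showing that the linearization coefficient A₁ = -(a/3)[ω_s^{1/3} l'(ω_s^{1/3}) + 3 l(ω_s^{1/3})] is negative.) -/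
theorem aux_sinh_lt (y : ℝ) (hy : 0 < y) : Real.sinh y < y * Real.cosh y := by
  have h : StrictMonoOn (fun x : ℝ => x * Real.cosh x - Real.sinh x) (Set.Ici 0) := by
    apply strictMonoOn_of_deriv_pos (convex_Ici 0)
    · fun_prop
    · intro x hx
      rw [interior_Ici] at hx
      have hx0 : (0:ℝ) < x := hx
      have hd : HasDerivAt (fun x : ℝ => x * Real.cosh x - Real.sinh x)
          (1 * Real.cosh x + x * Real.sinh x - Real.cosh x) x :=
        ((hasDerivAt_id x).mul (Real.hasDerivAt_cosh x)).sub (Real.hasDerivAt_sinh x)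
      rw [hd.deriv]
      have := mul_pos hx0 (Real.sinh_pos_iff.2 hx0)
      linarith
  have := h (Set.mem_Ici.2 le_rfl) (Set.mem_Ici.2 hy.le) hy
  simp at this
  linarith

/-- Let `α > 0`, `Γ > 0`. For every `y > 0` one has `y·l'(y) + 3·l(y) > 0`, where
`l(x) = α p(x)/(α + √Γ g(x))`. -/
theorem key_inequality (α Γ : ℝ) (hα : 0 < α) (hΓ : 0 < Γ)
    (g p l : ℝ → ℝ)
    (hg : ∀ x, g x = Real.cosh x / Real.sinh x - 1 / x)
    (hp : ∀ x, p x = (x * (Real.cosh x / Real.sinh x) - 1) / x ^ 2)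
    (hl : ∀ x, l x = α * p x / (α + Real.sqrt Γ * g x)) :
    ∀ y : ℝ, 0 < y → 0 < y * deriv l y + 3 * l y := by
  intro y hy
  have hs : 0 < Real.sinh y := Real.sinh_pos_iff.2 hy
  have hsy : y < Real.sinh y := Real.self_lt_sinh_iff.2 hy
  have hgpos : 0 < g y := by
    rw [hg, sub_pos, div_lt_div_iff₀ hy hs]
    linarith [aux_sinh_lt y hy]
  obtain ⟨d, hd, hgd⟩ : ∃ d, 0 < d ∧ HasDerivAt g d y := by
    refine ⟨1 / y ^ 2 - 1 / Real.sinh y ^ 2, ?_, ?_⟩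
    · rw [sub_pos]
      apply one_div_lt_one_div_of_lt (by positivity)
      gcongr
    · have h1 := ((Real.hasDerivAt_cosh y).div (Real.hasDerivAt_sinh y) hs.ne').sub
        (hasDerivAt_inv hy.ne')
      have h2 : g = (Real.cosh / Real.sinh - fun x : ℝ => x⁻¹) := by
        funext x
        simp [hg]
      rw [h2]
      refine h1.congr_deriv ?_
      have := Real.cosh_sq y
      field_simp
      rw [this]
      ring
  have hpg : ∀ x, x ≠ 0 → p x = g x / x := by
    intro x hx
    rw [hp, hg]
    generalize Real.cosh x / Real.sinh x = c
    field_simp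
  have hr : 0 ≤ Real.sqrt Γ := Real.sqrt_nonneg Γ
  generalize Real.sqrt Γ = r at hl hr
  have hD : 0 < α + r * g y := by positivity
  have hld := ((hgd.div (hasDerivAt_id y) hy.ne').const_mul α).div
    ((hgd.const_mul r).const_add α) hD.ne'
  have hev : l =ᶠ[nhds y] ((fun y => α * (g / id : ℝ → ℝ) y) / fun x => α + r * g x) := by
    filter_upwards [eventually_ne_nhds hy.ne'] with x hx
    rw [hl, hpg x hx]
    rfl
  rw [Filter.EventuallyEq.deriv_eq hev, HasDerivAt.deriv hld, hl, hpg y hy.ne']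
  simp only [id, Pi.div_apply]
  have : 0 < α * (α * d / (α + r * g y) ^ 2 + 2 * g y / (y * (α + r * g y))) := by positivity
  convert this using 1
  field_simp
  ring
end
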